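/- Let 𝒯 be a finite undirected tree, w : V(𝒯) → ℝ≥0 a weight function, m = w(𝒯), and let c be a centroid of (𝒯,w). Then OPT(𝒯,w) ≥ m/2 + w(c)/2 + Σ_{ℋ ∈ 𝒞(𝒯−c)} OPT(ℋ,w), where the sum ranges over the connected components of 𝒯 − c. -/

import Mathlib

open Filter Topology

universe u

variable {V : Type u}

/-- Rooted trees with vertices labelled by elements of `V`. -/
inductive RTree (V : Type u) : Type u where
  | node : V → List (RTree V) → RTree V

namespace RTree

/-- The root of a rooted tree. -/
def root : RTree V → V
  | node r _ => r

/-- The subtrees rooted at the children of the root. -/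
def children : RTree V → List (RTree V)
  | node _ ts => ts

/-- The list of pairs `(v, path from the root to v)` over all vertices `v` of the tree. -/
def pathsFrom : RTree V → List (V × List V)
  | node r ts =>
      (r, [r]) ::
        (ts.attach.map fun t => (t.1.pathsFrom.map fun p => (p.1, r :: p.2))).flatten
  decreasing_by
    simp only [RTree.node.sizeOf_spec]
    have := List.sizeOf_lt_of_mem t.2
    omega

/-- The vertex set of a rooted tree. -/
def vertSet (T : RTree V) : Set V := {v | ∃ p ∈ T.pathsFrom, p.1 = v}

/-- `Path_T(v)`: the set of vertices on the path in `T` from the root to `v`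
(including both endpoints). -/
def pathSet (T : RTree V) (v : V) : Set V := {x | ∃ p ∈ T.pathsFrom, p.1 = v ∧ x ∈ p.2}

/-- The depth of a vertex `v` in `T`; the root has depth 1. -/
noncomputable def depth (T : RTree V) (v : V) : ℕ := (T.pathSet v).ncard

/-- All subtrees of a rooted tree (including the tree itself). -/
def allSubtrees : RTree V → List (RTree V)
  | node r ts => node r ts :: (ts.attach.map fun t => t.1.allSubtrees).flatten
  decreasing_by
    simp only [RTree.node.sizeOf_spec]
    have := List.sizeOf_lt_of_mem t.2
    omega

/-- Two rooted trees are equivalent (represent the same search tree) if they have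
the same root-to-vertex paths. -/
def Equiv (T₁ T₂ : RTree V) : Prop := ∀ v, T₁.pathSet v = T₂.pathSet v

end RTree

/-- `x` and `y` are joined by a walk of `G` staying inside `s`. -/
def ReachIn (G : SimpleGraph V) (s : Set V) (x y : V) : Prop :=
  ∃ p : G.Walk x y, ∀ v ∈ p.support, v ∈ s

/-- The connected component of `x` in the subgraph of `G` induced by `s`. -/
def compIn (G : SimpleGraph V) (s : Set V) (x : V) : Set V := {y | ReachIn G s x y}

/-- The set of connected components of the subgraph of `G` induced by `s`. -/
def comps (G : SimpleGraph V) (s : Set V) : Set (Set V) := {c | ∃ x ∈ s, c = compIn G s x}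

/-- `s` induces a (nonempty) connected subgraph of `G`. -/
def ConnIn (G : SimpleGraph V) (s : Set V) : Prop :=
  s.Nonempty ∧ ∀ x ∈ s, ∀ y ∈ s, ReachIn G s x y

/-- The total weight of a set of vertices. -/
noncomputable def wsum (w : V → ℝ) (s : Set V) : ℝ := ∑ᶠ x ∈ s, w x

/-- `IsSearchTree G s T`: `T` is a search tree on the subgraph of `G` induced by `s`.
Its root `r` is a vertex of `s`, its vertex set is `s`, and the subtrees rooted at the
children of `r` are search trees on the connected components of the induced subgraph
on `s \ {r}` (one subtree for each component). -/
inductive IsSearchTree (G : SimpleGraph V) : Set V → RTree V → Prop where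
  | node {s : Set V} {r : V} {ts : List (RTree V)} :
      r ∈ s →
      (RTree.node r ts).vertSet = s →
      (∀ t ∈ ts, IsSearchTree G (compIn G (s \ {r}) t.root) t) →
      ts.Pairwise (fun t₁ t₂ => compIn G (s \ {r}) t₁.root ≠ compIn G (s \ {r}) t₂.root) →
      IsSearchTree G s (RTree.node r ts)

/-- The cost of a search tree: `∑_x w(x) · depth(x)`, the root having depth 1. -/
noncomputable def cost (w : V → ℝ) (T : RTree V) : ℝ :=
  ∑ᶠ v ∈ T.vertSet, w v * (T.depth v : ℝ)

/-- The optimum cost of a search tree on the subgraph of `G` induced by `s`. -/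
noncomputable def OPT (G : SimpleGraph V) (w : V → ℝ) (s : Set V) : ℝ :=
  sInf (cost w '' {T | IsSearchTree G s T})

/-- `v` is an `α`-centroid of the subgraph of `G` induced by `s` (with weights `w`):
every connected component of the induced subgraph on `s \ {v}` has weight at most
`α` times the weight of `s`. -/
def IsAlphaCentroid (G : SimpleGraph V) (w : V → ℝ) (α : ℝ) (s : Set V) (v : V) : Prop :=
  v ∈ s ∧ ∀ x ∈ s \ {v}, wsum w (compIn G (s \ {v}) x) ≤ α * wsum w s

/-- `v` is a centroid of the subgraph of `G` induced by `s` (with weights `w`). -/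
def IsCentroid (G : SimpleGraph V) (w : V → ℝ) (s : Set V) (v : V) : Prop :=
  v ∈ s ∧ ∀ x ∈ s \ {v}, wsum w (compIn G (s \ {v}) x) ≤ wsum w s / 2

/-- `T` is an `α`-centroid tree on the subgraph of `G` induced by `s`. -/
def IsAlphaCentroidTree (G : SimpleGraph V) (w : V → ℝ) (α : ℝ) (s : Set V) (T : RTree V) :
    Prop :=
  IsSearchTree G s T ∧ ∀ t ∈ T.allSubtrees, IsAlphaCentroid G w α t.vertSet t.root

/-- `T` is a centroid tree on the subgraph of `G` induced by `s`. -/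
def IsCentroidTree (G : SimpleGraph V) (w : V → ℝ) (s : Set V) (T : RTree V) : Prop :=
  IsSearchTree G s T ∧ ∀ t ∈ T.allSubtrees, IsCentroid G w t.vertSet t.root

/-- `cent(𝒯,w)`: the maximum cost of a centroid tree. -/
noncomputable def centCost (G : SimpleGraph V) (w : V → ℝ) (s : Set V) : ℝ :=
  sSup (cost w '' {T | IsCentroidTree G w s T})

/-- `centᵅ(𝒯,w)`: the maximum cost of an `α`-centroid tree (`0` if none exists, since
`sSup ∅ = 0` in `ℝ`). -/
noncomputable def centCostA (G : SimpleGraph V) (w : V → ℝ) (α : ℝ) (s : Set V) : ℝ :=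
  sSup (cost w '' {T | IsAlphaCentroidTree G w α s T})

/-- `b` is a child of `a` in the rooted tree `T`. -/
def ChildRel (T : RTree V) (a b : V) : Prop :=
  ∃ t ∈ T.allSubtrees, t.root = a ∧ ∃ t' ∈ t.children, t'.root = b

namespace RTree

theorem pathsFrom_node (r : V) (ts : List (RTree V)) (p : V × List V) :
    p ∈ (node r ts).pathsFrom ↔
      p = (r, [r]) ∨ ∃ t ∈ ts, ∃ q ∈ t.pathsFrom, (q.1, r :: q.2) = p := by
  rw [pathsFrom]
  simp only [List.mem_cons, List.mem_flatten, List.mem_map, List.mem_attach, true_and,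
    Subtype.exists]
  constructor
  · rintro (h | ⟨l, ⟨t, ht, rfl⟩, hp⟩)
    · exact Or.inl h
    · obtain ⟨q, hq, h⟩ := List.mem_map.1 hp
      exact Or.inr ⟨t, ht, q, hq, h⟩
  · rintro (h | ⟨t, ht, q, hq, h⟩)
    · exact Or.inl h
    · exact Or.inr ⟨_, ⟨t, ht, rfl⟩, List.mem_map.2 ⟨q, hq, h⟩⟩

theorem mem_vertSet_node {r x : V} {ts : List (RTree V)} :
    x ∈ (node r ts).vertSet ↔ x = r ∨ ∃ t ∈ ts, x ∈ t.vertSet := by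
  simp only [vertSet, Set.mem_ofPred_eq, pathsFrom_node]
  constructor
  · rintro ⟨p, rfl | ⟨t, ht, q, hq, rfl⟩, rfl⟩
    · exact Or.inl rfl
    · exact Or.inr ⟨t, ht, q, hq, rfl⟩
  · rintro (rfl | ⟨t, ht, q, hq, rfl⟩)
    · exact ⟨_, Or.inl rfl, rfl⟩
    · exact ⟨_, Or.inr ⟨t, ht, q, hq, rfl⟩, rfl⟩

theorem mem_pathSet_node {r x y : V} {ts : List (RTree V)} :
    y ∈ (node r ts).pathSet x ↔
      (x = r ∧ y = r) ∨ ∃ t ∈ ts, x ∈ t.vertSet ∧ (y = r ∨ y ∈ t.pathSet x) := by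
  simp only [vertSet, pathSet, Set.mem_ofPred_eq, pathsFrom_node]
  constructor
  · rintro ⟨p, rfl | ⟨t, ht, q, hq, rfl⟩, rfl, hy⟩
    · exact Or.inl ⟨rfl, by simpa using hy⟩
    · rcases List.mem_cons.1 hy with h | h
      · exact Or.inr ⟨t, ht, ⟨q, hq, rfl⟩, Or.inl h⟩
      · exact Or.inr ⟨t, ht, ⟨q, hq, rfl⟩, Or.inr ⟨q, hq, rfl, h⟩⟩
  · rintro (⟨rfl, rfl⟩ | ⟨t, ht, ⟨q, hq, rfl⟩, rfl | ⟨q', hq', h, hy⟩⟩)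
    · exact ⟨_, Or.inl rfl, rfl, by simp⟩
    · exact ⟨_, Or.inr ⟨t, ht, q, hq, rfl⟩, rfl, by simp⟩
    · exact ⟨_, Or.inr ⟨t, ht, q', hq', rfl⟩, h, List.mem_cons_of_mem _ hy⟩

theorem root_mem_vertSet (T : RTree V) : T.root ∈ T.vertSet := by
  cases T
  exact mem_vertSet_node.2 (Or.inl rfl)

theorem root_mem_pathSet {T : RTree V} {x : V} (hx : x ∈ T.vertSet) : T.root ∈ T.pathSet x := by
  cases T
  rcases mem_vertSet_node.1 hx with h | ⟨t, ht, h⟩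
  · exact mem_pathSet_node.2 (Or.inl ⟨h, rfl⟩)
  · exact mem_pathSet_node.2 (Or.inr ⟨t, ht, h, Or.inl rfl⟩)

end RTree

section Components

variable {G : SimpleGraph V} {s t : Set V} {x y z : V}

theorem ReachIn.refl (hx : x ∈ s) : ReachIn G s x x := ⟨.nil, by simpa using hx⟩

theorem ReachIn.symm (h : ReachIn G s x y) : ReachIn G s y x := by
  obtain ⟨p, hp⟩ := h
  exact ⟨p.reverse, by simpa using hp⟩

theorem ReachIn.trans (h : ReachIn G s x y) (h' : ReachIn G s y z) : ReachIn G s x z := by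
  obtain ⟨p, hp⟩ := h
  obtain ⟨q, hq⟩ := h'
  refine ⟨p.append q, fun v hv => ?_⟩
  rcases (SimpleGraph.Walk.mem_support_append_iff p q).1 hv with h | h
  exacts [hp v h, hq v h]

theorem ReachIn.mono (hst : s ⊆ t) (h : ReachIn G s x y) : ReachIn G t x y := by
  obtain ⟨p, hp⟩ := h
  exact ⟨p, fun v hv => hst (hp v hv)⟩

theorem compIn_subset : compIn G s x ⊆ s := by
  rintro y ⟨p, hp⟩
  exact hp y p.end_mem_support

theorem mem_compIn_self (hx : x ∈ s) : x ∈ compIn G s x := ReachIn.refl hx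

theorem compIn_eq_of_mem (h : y ∈ compIn G s x) : compIn G s y = compIn G s x := by
  ext z
  exact ⟨fun hz => ReachIn.trans h hz, fun hz => (ReachIn.symm h).trans hz⟩

theorem compIn_eq_of_mem_comps {C : Set V} (hC : C ∈ comps G s) (hx : x ∈ C) :
    compIn G s x = C := by
  obtain ⟨y, -, rfl⟩ := hC
  exact compIn_eq_of_mem hx

theorem subset_of_mem_comps {C : Set V} (hC : C ∈ comps G s) : C ⊆ s := by
  obtain ⟨y, -, rfl⟩ := hC
  exact compIn_subset

theorem connIn_of_mem_comps {C : Set V} (hC : C ∈ comps G s) : ConnIn G C := by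
  classical
  refine ⟨?_, fun x hx y hy => ?_⟩
  · obtain ⟨y, hy, rfl⟩ := hC
    exact ⟨y, mem_compIn_self hy⟩
  · rw [← compIn_eq_of_mem_comps hC hx] at hy ⊢
    obtain ⟨p, hp⟩ := hy
    exact ⟨p, fun v hv => ⟨p.takeUntil v hv, fun u hu =>
      hp u (p.support_takeUntil_subset_support hv hu)⟩⟩

theorem ConnIn.subset_compIn (hs : ConnIn G s) (hst : s ⊆ t) (hx : x ∈ s) (hy : x ∈ compIn G t y) :
    s ⊆ compIn G t y :=
  fun z hz => ReachIn.trans hy ((hs.2 x hx z hz).mono hst)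

end Components

section SearchTrees

variable {G : SimpleGraph V} {s : Set V}

theorem IsSearchTree.vertSet_eq {T : RTree V} (h : IsSearchTree G s T) : T.vertSet = s := by
  cases h
  assumption

/-- Search trees on the components of `s \ {r}` assemble to a search tree on `s` with root `r`. -/
theorem exists_isSearchTree_of_comps [Finite V] {r : V} (hr : r ∈ s) (F : V → Set V)
    (hF : ∀ x ∈ s, r ∈ F x)
    (h : ∀ C ∈ comps G (s \ {r}), ∃ T, IsSearchTree G C T ∧ ∀ x ∈ C, T.pathSet x ⊆ F x) :
    ∃ T, IsSearchTree G s T ∧ ∀ x ∈ s, T.pathSet x ⊆ F x := by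
  classical
  have : Nonempty (RTree V) := ⟨.node r []⟩
  choose! f hf hfF using h
  have hfin : (comps G (s \ {r})).Finite := Set.toFinite _
  have hroot : ∀ C ∈ comps G (s \ {r}), compIn G (s \ {r}) (f C).root = C := fun C hC =>
    compIn_eq_of_mem_comps hC ((hf C hC).vertSet_eq.subset (f C).root_mem_vertSet)
  have hmem : ∀ t, t ∈ hfin.toFinset.toList.map f ↔ ∃ C ∈ comps G (s \ {r}), f C = t := by
    simp
  refine ⟨.node r (hfin.toFinset.toList.map f), .node hr ?_ ?_ ?_, ?_⟩
  · ext x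
    simp only [RTree.mem_vertSet_node, hmem]
    constructor
    · rintro (rfl | ⟨_, ⟨C, hC, rfl⟩, hx⟩)
      · exact hr
      · rw [(hf C hC).vertSet_eq] at hx
        exact (subset_of_mem_comps hC hx).1
    · intro hx
      by_cases hxr : x = r
      · exact Or.inl hxr
      · have hC : compIn G (s \ {r}) x ∈ comps G (s \ {r}) := ⟨x, ⟨hx, hxr⟩, rfl⟩
        exact Or.inr ⟨_, ⟨_, hC, rfl⟩, (hf _ hC).vertSet_eq.superset (mem_compIn_self ⟨hx, hxr⟩)⟩
  · intro t ht
    obtain ⟨C, hC, rfl⟩ := (hmem t).1 ht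
    rw [hroot C hC]
    exact hf C hC
  · rw [List.pairwise_map]
    refine List.Nodup.pairwise_of_forall_ne (Finset.nodup_toList _) ?_
    intro C hC D hD hne
    rw [hroot C (by simpa using hC), hroot D (by simpa using hD)]
    exact hne
  · intro x hx y hy
    rcases RTree.mem_pathSet_node.1 hy with ⟨rfl, rfl⟩ | ⟨t, ht, hxt, rfl | hy⟩
    · exact hF _ hx
    · exact hF _ hx
    · obtain ⟨C, hC, rfl⟩ := (hmem t).1 ht
      rw [(hf C hC).vertSet_eq] at hxt
      exact hfF C hC x hxt hy

theorem exists_isSearchTree [Finite V] (hs : s.Nonempty) : ∃ T, IsSearchTree G s T := by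
  induction hn : s.ncard using Nat.strong_induction_on generalizing s with
  | _ n ih =>
    obtain ⟨r, hr⟩ := hs
    obtain ⟨T, hT, -⟩ := exists_isSearchTree_of_comps (G := G) hr (fun _ => Set.univ)
      (fun _ _ => Set.mem_univ _) fun C hC => by
        obtain ⟨T, hT⟩ := ih C.ncard
          (hn ▸ (Set.ncard_le_ncard (subset_of_mem_comps hC)).trans_lt
            (Set.ncard_sdiff_singleton_lt_of_mem hr)) (connIn_of_mem_comps hC).1 rfl
        exact ⟨T, hT, fun _ _ => Set.subset_univ _⟩
    exact ⟨T, hT⟩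

theorem IsSearchTree.mem_pathSet_self {T : RTree V} (h : IsSearchTree G s T) {x : V}
    (hx : x ∈ s) : x ∈ T.pathSet x := by
  induction h with
  | @node s r ts hr hv hts _ ih =>
    rcases RTree.mem_vertSet_node.1 (hv ▸ hx) with rfl | ⟨t, ht, hxt⟩
    · exact RTree.mem_pathSet_node.2 (Or.inl ⟨rfl, rfl⟩)
    · exact RTree.mem_pathSet_node.2
        (Or.inr ⟨t, ht, hxt, Or.inr (ih t ht ((hts t ht).vertSet_eq ▸ hxt))⟩)

/-- A search tree restricts to a search tree on every connected vertex subset, whose root paths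
consist of vertices of the original root paths. -/
theorem IsSearchTree.exists_restrict [Finite V] {T : RTree V} (h : IsSearchTree G s T)
    {H : Set V} (hH : ConnIn G H) (hHs : H ⊆ s) :
    ∃ T', IsSearchTree G H T' ∧ ∀ x ∈ H, T'.pathSet x ⊆ T.pathSet x ∩ H := by
  induction h generalizing H with
  | @node s r ts hr hv hts _ ih =>
    have key : ∀ C : Set V, ConnIn G C → C ⊆ s \ {r} → ∃ T', IsSearchTree G C T' ∧
        ∀ x ∈ C, T'.pathSet x ⊆ (RTree.node r ts).pathSet x ∩ C := by
      intro C hC hCs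
      obtain ⟨x, hx⟩ := hC.1
      rcases RTree.mem_vertSet_node.1 (hv ▸ (hCs hx).1) with hxr | ⟨t, ht, hxt⟩
      · exact absurd hxr (hCs hx).2
      rw [(hts t ht).vertSet_eq] at hxt
      have hsub := hC.subset_compIn hCs hx hxt
      obtain ⟨T', hT', hp⟩ := ih t ht hC hsub
      refine ⟨T', hT', fun y hy z hz => ⟨?_, (hp y hy hz).2⟩⟩
      exact RTree.mem_pathSet_node.2
        (Or.inr ⟨t, ht, (hts t ht).vertSet_eq ▸ hsub hy, Or.inr (hp y hy hz).1⟩)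
    by_cases hrH : r ∈ H
    · refine exists_isSearchTree_of_comps hrH _ (fun x hx => ⟨?_, hrH⟩) fun C hC => ?_
      · exact RTree.root_mem_pathSet (T := .node r ts) (hv ▸ hHs hx)
      · have hCH := subset_of_mem_comps hC
        obtain ⟨T', hT', hp⟩ := key C (connIn_of_mem_comps hC)
          (hCH.trans (Set.sdiff_subset_sdiff_left hHs))
        exact ⟨T', hT', fun x hx => (hp x hx).trans
          (Set.inter_subset_inter_right _ fun y hy => (hCH hy).1)⟩
    · exact key H hH fun x hx => ⟨hHs hx, fun hxr => hrH (hxr ▸ hx)⟩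

end SearchTrees

section Costs

variable {G : SimpleGraph V} {w : V → ℝ}

theorem finsum_mem_eq_sum_ite [Fintype V] (f : V → ℝ) (s : Set V) [DecidablePred (· ∈ s)] :
    ∑ᶠ x ∈ s, f x = ∑ x, if x ∈ s then f x else 0 := by
  rw [finsum_eq_sum_of_fintype]
  exact Finset.sum_congr rfl fun x _ => finsum_eq_if

theorem OPT_le_cost [Finite V] (hw : ∀ x, 0 ≤ w x) {s : Set V} {T : RTree V}
    (hT : IsSearchTree G s T) : OPT G w s ≤ cost w T := by
  refine csInf_le ⟨0, ?_⟩ ⟨T, hT, rfl⟩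
  rintro _ ⟨T', -, rfl⟩
  exact finsum_nonneg fun x => finsum_nonneg fun _ => mul_nonneg (hw x) (Nat.cast_nonneg _)

open scoped Classical in
theorem IsSearchTree.OPT_le_sum_inter [Fintype V] (hw : ∀ x, 0 ≤ w x) {s H : Set V}
    {T : RTree V} (hT : IsSearchTree G s T) (hH : ConnIn G H) (hHs : H ⊆ s) :
    OPT G w H ≤ ∑ x, if x ∈ H then w x * ((T.pathSet x ∩ H).ncard : ℝ) else 0 := by
  obtain ⟨T', hT', hp⟩ := hT.exists_restrict hH hHs
  refine (OPT_le_cost hw hT').trans ?_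
  rw [cost, hT'.vertSet_eq, finsum_mem_eq_sum_ite]
  refine Finset.sum_le_sum fun x _ => ?_
  split_ifs with hx
  · exact mul_le_mul_of_nonneg_left (by exact_mod_cast Set.ncard_le_ncard (hp x hx)) (hw x)
  · exact le_rfl

theorem IsSearchTree.finsum_OPT_comps_le [Fintype V] (hw : ∀ x, 0 ≤ w x) {T : RTree V}
    (hT : IsSearchTree G Set.univ T) (s : Set V) [DecidablePred (· ∈ s)] :
    ∑ᶠ H ∈ comps G s, OPT G w H ≤
      ∑ x, if x ∈ s then w x * ((T.pathSet x ∩ compIn G s x).ncard : ℝ) else 0 := by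
  classical
  have hfin : (comps G s).Finite := Set.toFinite _
  rw [finsum_mem_eq_finite_toFinset_sum _ hfin]
  refine (Finset.sum_le_sum fun H hH => hT.OPT_le_sum_inter hw
    (connIn_of_mem_comps (hfin.mem_toFinset.1 hH)) (Set.subset_univ _)).trans ?_
  rw [Finset.sum_comm]
  refine Finset.sum_le_sum fun x _ => ?_
  split_ifs with hx
  · rw [Finset.sum_eq_single_of_mem (compIn G s x) (hfin.mem_toFinset.2 ⟨x, hx, rfl⟩),
      if_pos (mem_compIn_self hx)]
    intro H hH hne
    rw [if_neg fun hxH => hne (compIn_eq_of_mem_comps (hfin.mem_toFinset.1 hH) hxH).symm]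
  · refine (Finset.sum_eq_zero fun H hH => if_neg fun hxH => hx ?_).le
    exact subset_of_mem_comps (hfin.mem_toFinset.1 hH) hxH

end Costs

theorem opt_lower_bound_centroid {V : Type} [Fintype V]
    (G : SimpleGraph V) (hG : G.IsTree) (w : V → ℝ) (hw : ∀ x, 0 ≤ w x)
    (c : V) (hc : IsCentroid G w Set.univ c) :
    OPT G w Set.univ ≥
      wsum w Set.univ / 2 + w c / 2 + ∑ᶠ H ∈ comps G (Set.univ \ {c}), OPT G w H := by
  classical
  obtain ⟨T₀, hT₀⟩ := exists_isSearchTree (G := G) (s := Set.univ) ⟨c, Set.mem_univ c⟩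
  refine le_csInf ⟨_, T₀, hT₀, rfl⟩ ?_
  rintro _ ⟨T, hT, rfl⟩
  have hT' : IsSearchTree G Set.univ T := hT
  have hsum := hT'.finsum_OPT_comps_le hw (Set.univ \ {c})
  have hroot : ∀ x, T.root ∈ T.pathSet x := fun x =>
    RTree.root_mem_pathSet (hT'.vertSet_eq ▸ Set.mem_univ x)
  have hself : ∀ x, x ∈ T.pathSet x := fun x => hT'.mem_pathSet_self (Set.mem_univ x)
  have hm : wsum w Set.univ = ∑ x, w x := by simp [wsum, finsum_eq_sum_of_fintype]
  have hcost : cost w T = ∑ x, w x * ((T.pathSet x).ncard : ℝ) := by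
    simp [cost, hT'.vertSet_eq, finsum_eq_sum_of_fintype, RTree.depth]
  have hinter : ∀ x y (C : Set V), y ∈ T.pathSet x → y ∉ C →
      ((T.pathSet x ∩ C).ncard : ℝ) + 1 ≤ (T.pathSet x).ncard := by
    intro x y C hy hyC
    have : (T.pathSet x ∩ C).ncard < (T.pathSet x).ncard :=
      Set.ncard_lt_ncard ⟨Set.inter_subset_left, fun h => hyC (h hy).2⟩
    exact_mod_cast this
  have hcle : w c ≤ ∑ x, w x :=
    Finset.single_le_sum (fun x _ => hw x) (Finset.mem_univ c)
  by_cases hrc : T.root = c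
  · have hpt : (∑ x, w x) + (∑ x, if x ∈ Set.univ \ {c} then
        w x * ((T.pathSet x ∩ compIn G (Set.univ \ {c}) x).ncard : ℝ) else 0) ≤ cost w T := by
      rw [hcost, ← Finset.sum_add_distrib]
      refine Finset.sum_le_sum fun x _ => ?_
      split_ifs with hx
      · have := hinter x T.root (compIn G (Set.univ \ {c}) x) (hroot x)
          fun h => (compIn_subset h).2 hrc
        nlinarith [hw x]
      · have := hinter x T.root ∅ (hroot x) (by simp)
        simp only [Set.inter_empty, Set.ncard_empty, Nat.cast_zero, zero_add] at this
        nlinarith [hw x]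
    linarith
  · set H := compIn G (Set.univ \ {c}) T.root with hH
    have hcent : wsum w H ≤ wsum w Set.univ / 2 := hc.2 T.root ⟨Set.mem_univ _, hrc⟩
    have hwH : wsum w H = ∑ x, if x ∈ H then w x else 0 := finsum_mem_eq_sum_ite _ _
    have hwc : w c = ∑ x, if x = c then w x else 0 := by simp
    have hpt : (∑ x, w x) + (∑ x, if x = c then w x else 0) +
        (∑ x, if x ∈ Set.univ \ {c} then
          w x * ((T.pathSet x ∩ compIn G (Set.univ \ {c}) x).ncard : ℝ) else 0) ≤
        cost w T + ∑ x, if x ∈ H then w x else 0 := by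
      rw [hcost, ← Finset.sum_add_distrib, ← Finset.sum_add_distrib, ← Finset.sum_add_distrib]
      refine Finset.sum_le_sum fun x _ => ?_
      by_cases hxc : x = c
      · subst hxc
        have hxH : x ∉ H := fun h => (compIn_subset h).2 rfl
        have h2 := hinter x T.root {x} (hroot x) hrc
        rw [Set.inter_eq_right.2 (Set.singleton_subset_iff.2 (hself x)),
          Set.ncard_singleton] at h2
        push_cast at h2
        simp only [if_true, hxH, if_false, Set.mem_sdiff, Set.mem_univ, Set.mem_singleton_iff,
          not_true_eq_false, and_false]
        nlinarith [hw x]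
      · have hx : x ∈ Set.univ \ {c} := ⟨Set.mem_univ x, hxc⟩
        rw [if_neg hxc, if_pos hx]
        split_ifs with hxH
        · have : ((T.pathSet x ∩ compIn G (Set.univ \ {c}) x).ncard : ℝ) ≤
              (T.pathSet x).ncard := by
            exact_mod_cast Set.ncard_le_ncard Set.inter_subset_left
          nlinarith [hw x]
        · have := hinter x T.root (compIn G (Set.univ \ {c}) x) (hroot x)
            fun h => hxH (ReachIn.symm h)
          nlinarith [hw x]
    have := hw c
    linarith
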